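/- arXiv:1810.04248 — 2 statements merged into one kernel-verified Lean document; each statement's English description precedes it below -/
import Mathlib

section
/- Let g be a flag in F^n, let M be its minimal matrix representation, and let ĝ be the maximal flag whose j-th subspace is the span of the first j columns of M (j = 1,…,n−1). Then g ⊆ ĝ, and for every maximal flag h with g ⊆ h and h ≠ ĝ, the label of ĝ is lexicographically strictly smaller than the label of h. Consequently minlabel(g) equals the label of ĝ, i.e., g ∈ X_{label(ĝ)}. -/
open Matrix

variable {n : ℕ} {F : Type} [Field F]

/-- `(r, j)` is a pivot position of `M`: the entry `M r j` is nonzero and all entries of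
column `j` strictly below row `r` vanish (i.e. `r` is the largest row index with `M r j ≠ 0`). -/
def IsPivot (M : Matrix (Fin n) (Fin n) F) (r j : Fin n) : Prop :=
  M r j ≠ 0 ∧ ∀ r' : Fin n, r < r' → M r' j = 0

/-- The span of the first `j` columns of `M` (columns with index `< j` in 0-based indexing). -/
def colSpan (M : Matrix (Fin n) (Fin n) F) (j : ℕ) : Submodule F (Fin n → F) :=
  Submodule.span F ((fun i : Fin n => Mᵀ i) '' {i : Fin n | (i : ℕ) < j})

/-- A flag: a nonempty finite set of proper nonzero subspaces of `F^n` forming a chain. -/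
def IsFlag (g : Set (Submodule F (Fin n → F))) : Prop :=
  g.Finite ∧ g.Nonempty ∧ IsChain (· ≤ ·) g ∧ ∀ V ∈ g, V ≠ ⊥ ∧ V ≠ ⊤

/-- A maximal flag: a flag containing a subspace of every dimension `1,…,n-1`. -/
def IsMaximalFlag (f : Set (Submodule F (Fin n → F))) : Prop :=
  IsFlag f ∧ ∀ j : ℕ, 1 ≤ j → j ≤ n - 1 → ∃ V ∈ f, Module.finrank F V = j

/-- Conditions (i)–(iii) for a matrix representation of a flag `f`:
(i) for every `V ∈ f` the first `dim V` columns of `M` span `V`, and all `n` columns span `F^n`;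
(ii) every pivot entry equals `1`;
(iii) entries in the same row as a pivot and strictly to its right vanish. -/
def IsRep (f : Set (Submodule F (Fin n → F))) (M : Matrix (Fin n) (Fin n) F) : Prop :=
  (∀ V ∈ f, colSpan M (Module.finrank F V) = V) ∧
  colSpan M n = ⊤ ∧
  (∀ r j : Fin n, IsPivot M r j → M r j = 1) ∧
  (∀ r j j' : Fin n, IsPivot M r j → j < j' → M r j' = 0)

/-- Columns `i` and `i'` lie in the same block of the block decomposition induced by the
flag `g` (blocks are the intervals of columns between consecutive dimensions of members of `g`). -/
def SameBlock (g : Set (Submodule F (Fin n → F))) (i i' : Fin n) : Prop :=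
  ∀ V ∈ g, ((i : ℕ) < Module.finrank F V ↔ (i' : ℕ) < Module.finrank F V)

/-- The minimal matrix representation of a flag `g`: conditions (i)–(iii) together with
(iv) within each block, entries in the same row as a pivot of the block and strictly to its left
within the block vanish; (v) within each block, pivot row indices strictly increase. -/
def IsMinRep (g : Set (Submodule F (Fin n → F))) (M : Matrix (Fin n) (Fin n) F) : Prop :=
  IsRep g M ∧
  (∀ r i i' : Fin n, SameBlock g i i' → IsPivot M r i → i' < i → M r i' = 0) ∧
  (∀ r r' i i' : Fin n, SameBlock g i i' → IsPivot M r i → IsPivot M r' i' → i < i' → r < r')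

/-- `σ` is the label of the maximal flag `f`: `σ j` is the pivot row of the `j`-th column of
the minimal matrix representation of `f`. -/
def IsLabel (f : Set (Submodule F (Fin n → F))) (σ : Equiv.Perm (Fin n)) : Prop :=
  ∃ M : Matrix (Fin n) (Fin n) F, IsRep f M ∧ ∀ j : Fin n, IsPivot M (σ j) j

/-- Strict lexicographic order on permutations in one-line notation `(σ 0, …, σ (n-1))`. -/
def LexLt {n : ℕ} (σ τ : Equiv.Perm (Fin n)) : Prop :=
  ∃ j : Fin n, (∀ i : Fin n, i < j → σ i = τ i) ∧ σ j < τ j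

/-- `σ` is the lexicographically least label among the labels of maximal flags containing `g`. -/
def IsMinlabel (g : Set (Submodule F (Fin n → F))) (σ : Equiv.Perm (Fin n)) : Prop :=
  (∃ f, IsMaximalFlag f ∧ g ⊆ f ∧ IsLabel f σ) ∧
  ∀ (f : Set (Submodule F (Fin n → F))) (τ : Equiv.Perm (Fin n)),
    IsMaximalFlag f → g ⊆ f → IsLabel f τ → σ = τ ∨ LexLt σ τ

/-- `t` is a (0-based) ascent of `σ`: `σ t < σ (t+1)`.  (In the 1-based indexing of the paper
this corresponds to the ascent `(σ(t+1), σ(t+2))` at position `t+1`.) -/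
def Ascent {n : ℕ} (σ : Equiv.Perm (Fin n)) (t : ℕ) : Prop :=
  ∃ h : t + 1 < n, σ ⟨t, Nat.lt_of_succ_lt h⟩ < σ ⟨t + 1, h⟩

/-- `σ` is the decreasing permutation `σ(j) = n + 1 - j` (in 0-based indexing, `n - 1 - j`). -/
def IsDecreasing {n : ℕ} (σ : Equiv.Perm (Fin n)) : Prop :=
  ∀ j : Fin n, (σ j : ℕ) = n - 1 - (j : ℕ)

/-- `r` is the largest index at which `v` does not vanish. -/
def IsLastNonzero (v : Fin n → F) (r : Fin n) : Prop :=
  v r ≠ 0 ∧ ∀ r' : Fin n, r < r' → v r' = 0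

theorem IsLastNonzero.unique {v : Fin n → F} {r s : Fin n}
    (hr : IsLastNonzero v r) (hs : IsLastNonzero v s) : r = s := by
  rcases lt_trichotomy r s with h | h | h
  · exact absurd (hr.2 s h) hs.1
  · exact h
  · exact absurd (hs.2 r h) hr.1

theorem exists_isLastNonzero {v : Fin n → F} (hv : v ≠ 0) : ∃ r, IsLastNonzero v r := by
  classical
  obtain ⟨k, hk⟩ := Function.ne_iff.1 hv
  obtain ⟨r, hr, hmax⟩ := Finset.exists_max_image (Finset.univ.filter fun i => v i ≠ 0) id
    ⟨k, by simpa using hk⟩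
  refine ⟨r, by simpa using hr, fun r' hlt => ?_⟩
  by_contra hne
  exact absurd (hmax r' (by simpa using hne)) (not_le.2 hlt)

theorem IsPivot.isLastNonzero {M : Matrix (Fin n) (Fin n) F} {r j : Fin n}
    (h : IsPivot M r j) : IsLastNonzero (Mᵀ j) r := h

/-- A nontrivial combination of columns with distinct pivots ends at the largest pivot
that occurs in it. -/
theorem exists_isLastNonzero_sum {M : Matrix (Fin n) (Fin n) F} {μ : Equiv.Perm (Fin n)}
    (hp : ∀ j, IsPivot M (μ j) j) {c : Fin n → F} (hc : c ≠ 0) :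
    ∃ i, c i ≠ 0 ∧ (∀ k, c k ≠ 0 → μ k ≤ μ i) ∧ IsLastNonzero (∑ k, c k • Mᵀ k) (μ i) := by
  classical
  obtain ⟨k, hk⟩ := Function.ne_iff.1 hc
  obtain ⟨i, hi, hmax⟩ := Finset.exists_max_image (Finset.univ.filter fun i => c i ≠ 0) μ
    ⟨k, by simpa using hk⟩
  have hi' : c i ≠ 0 := by simpa using hi
  have hmax' : ∀ k, c k ≠ 0 → μ k ≤ μ i := fun k hk => hmax k (by simpa using hk)
  refine ⟨i, hi', hmax', ?_, fun r hr => ?_⟩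
  · rw [Finset.sum_apply, Finset.sum_eq_single i]
    · exact mul_ne_zero hi' (hp i).1
    · intro k _ hki
      by_cases hk0 : c k = 0
      · simp [hk0]
      · have hlt : μ k < μ i := lt_of_le_of_ne (hmax' k hk0) (fun h => hki (μ.injective h))
        simp [(hp k).2 _ hlt]
    · simp
  · rw [Finset.sum_apply]
    refine Finset.sum_eq_zero fun k _ => ?_
    by_cases hk0 : c k = 0
    · simp [hk0]
    · simp [(hp k).2 _ ((hmax' k hk0).trans_lt hr)]

theorem col_mem_colSpan (M : Matrix (Fin n) (Fin n) F) {i : Fin n} {j : ℕ} (h : (i : ℕ) < j) :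
    Mᵀ i ∈ colSpan M j :=
  Submodule.subset_span ⟨i, h, rfl⟩

theorem colSpan_mono (M : Matrix (Fin n) (Fin n) F) : Monotone (colSpan M) := fun _ _ h =>
  Submodule.span_mono (Set.image_mono fun _ hi => lt_of_lt_of_le hi h)

theorem mem_colSpan_iff {M : Matrix (Fin n) (Fin n) F} {j : ℕ} {v : Fin n → F} :
    v ∈ colSpan M j ↔
      ∃ c : Fin n → F, (∀ i : Fin n, c i ≠ 0 → (i : ℕ) < j) ∧ v = ∑ i, c i • Mᵀ i := by
  classical
  constructor
  · intro hv
    induction hv using Submodule.span_induction with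
    | mem x hx =>
      obtain ⟨i, hi, rfl⟩ := hx
      refine ⟨Pi.single i 1, fun k hk => ?_, ?_⟩
      · by_cases hki : k = i
        · exact hki ▸ hi
        · simp [hki] at hk
      · refine ((Finset.sum_eq_single i (fun k _ hk => ?_) (by simp)).trans ?_).symm
        · simp [hk]
        · simp
    | zero => exact ⟨0, by simp, by simp⟩
    | add x y _ _ hx hy =>
      obtain ⟨c, hc, rfl⟩ := hx
      obtain ⟨d, hd, rfl⟩ := hy
      refine ⟨c + d, fun i hi => ?_, by simp [add_smul, Finset.sum_add_distrib]⟩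
      by_cases h0 : c i = 0
      · exact hd i fun h => hi (by simp [h0, h])
      · exact hc i h0
    | smul a x _ hx =>
      obtain ⟨c, hc, rfl⟩ := hx
      exact ⟨a • c, fun i hi => hc i fun h => hi (by simp [h]), by
        simp [Finset.smul_sum, mul_smul]⟩
  · rintro ⟨c, hc, rfl⟩
    refine Submodule.sum_mem _ fun i _ => ?_
    by_cases h0 : c i = 0
    · simp [h0]
    · exact Submodule.smul_mem _ _ (col_mem_colSpan M (hc i h0))

theorem exists_pivot_of_mem_colSpan {M : Matrix (Fin n) (Fin n) F} {μ : Equiv.Perm (Fin n)}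
    (hp : ∀ j, IsPivot M (μ j) j) {v : Fin n → F} {b : ℕ} {r : Fin n}
    (hv : v ∈ colSpan M b) (hr : IsLastNonzero v r) :
    ∃ i : Fin n, (i : ℕ) < b ∧ μ i = r ∧
      ∀ m : ℕ, (∀ k : Fin n, (k : ℕ) < b → μ k ≤ r → (k : ℕ) < m) → v ∈ colSpan M m := by
  obtain ⟨c, hc, rfl⟩ := mem_colSpan_iff.1 hv
  have hc0 : c ≠ 0 := by
    rintro rfl
    exact hr.1 (by simp)
  obtain ⟨i, hi, hmax, hlast⟩ := exists_isLastNonzero_sum hp hc0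
  have hir := hlast.unique hr
  exact ⟨i, hc i hi, hir, fun m hm => mem_colSpan_iff.2
    ⟨c, fun k hk => hm k (hc k hk) (hir ▸ hmax k hk), rfl⟩⟩

/-- If two column flags agree at `j` and at `b > j`, and the pivots of the first increase
between `j` and `b`, then its pivot in column `j` is at most that of the second; if the
pivots are equal, the column of the second matrix lies in the next span of the first. -/
theorem pivot_le_of_colSpan_eq {M N : Matrix (Fin n) (Fin n) F} {μ τ : Equiv.Perm (Fin n)}
    (hM : ∀ j, IsPivot M (μ j) j) (hN : ∀ j, IsPivot N (τ j) j) {j : Fin n} {b : ℕ}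
    (hjb : (j : ℕ) < b) (hj : colSpan M j = colSpan N j) (hb : colSpan M b = colSpan N b)
    (hmono : ∀ k : Fin n, j < k → (k : ℕ) < b → μ j < μ k) :
    μ j ≤ τ j ∧ (μ j = τ j → Nᵀ j ∈ colSpan M (j + 1)) := by
  obtain ⟨i, hib, hi, hmem⟩ := exists_pivot_of_mem_colSpan hM
    (hb ▸ col_mem_colSpan N hjb) (hN j).isLastNonzero
  refine ⟨?_, fun h => hmem _ fun k hkb hk => ?_⟩
  · rcases lt_trichotomy i j with hij | rfl | hij
    · obtain ⟨l, hl, hlτ, -⟩ := exists_pivot_of_mem_colSpan hN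
        (hj ▸ col_mem_colSpan M (show (i : ℕ) < j from hij)) (hM i).isLastNonzero
      rw [τ.injective (hlτ.trans hi)] at hl
      exact absurd hl (lt_irrefl _)
    · exact hi.le
    · exact hi ▸ (hmono i hij hib).le
  · by_contra hlt
    exact absurd (hk.trans h.ge) (not_le.2 (hmono k (by omega) hkb))

theorem pivot_eq_of_colSpan_eq {M N : Matrix (Fin n) (Fin n) F} {μ τ : Equiv.Perm (Fin n)}
    (hM : ∀ j, IsPivot M (μ j) j) (hN : ∀ j, IsPivot N (τ j) j) {j : Fin n}
    (hj : colSpan M j = colSpan N j) (hj' : colSpan M (j + 1) = colSpan N (j + 1)) :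
    μ j = τ j :=
  le_antisymm
    (pivot_le_of_colSpan_eq hM hN (Nat.lt_succ_self _) hj hj' fun _ _ _ => by omega).1
    (pivot_le_of_colSpan_eq hN hM (Nat.lt_succ_self _) hj.symm hj'.symm fun _ _ _ => by omega).1

theorem linearIndependent_cols {M : Matrix (Fin n) (Fin n) F} (h : colSpan M n = ⊤) :
    LinearIndependent F fun i => Mᵀ i := by
  refine linearIndependent_of_top_le_span_of_card_eq_finrank ?_ (by simp)
  rw [← h]
  exact Submodule.span_mono (Set.image_subset_range _ _)

theorem finrank_colSpan {M : Matrix (Fin n) (Fin n) F} (h : colSpan M n = ⊤) {j : ℕ}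
    (hj : j ≤ n) : Module.finrank F (colSpan M j) = j := by
  have hli : LinearIndependent F fun i : Fin j => Mᵀ (Fin.castLE hj i) :=
    (linearIndependent_cols h).comp _ (Fin.castLE_injective hj)
  have hs : colSpan M j = Submodule.span F (Set.range fun i : Fin j => Mᵀ (Fin.castLE hj i)) := by
    refine congrArg _ (Set.ext fun v => ⟨?_, ?_⟩)
    · rintro ⟨i, hi, rfl⟩
      exact ⟨⟨i, hi⟩, rfl⟩
    · rintro ⟨i, rfl⟩
      exact ⟨Fin.castLE hj i, i.2, rfl⟩
  rw [hs, finrank_span_eq_card hli, Fintype.card_fin]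

theorem IsRep.exists_perm {f : Set (Submodule F (Fin n → F))} {M : Matrix (Fin n) (Fin n) F}
    (h : IsRep f M) : ∃ μ : Equiv.Perm (Fin n), ∀ j, IsPivot M (μ j) j := by
  have hex : ∀ j, ∃ r, IsPivot M r j := fun j =>
    exists_isLastNonzero ((linearIndependent_cols h.2.1).ne_zero j)
  choose μ hμ using hex
  have hinj : Function.Injective μ := by
    intro i j hij
    rcases lt_trichotomy i j with hlt | heq | hlt
    · exact absurd (h.2.2.2 _ _ _ (hμ i) hlt) (hij ▸ (hμ j).1)
    · exact heq
    · exact absurd (h.2.2.2 _ _ _ (hμ j) hlt) (hij ▸ (hμ i).1)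
  exact ⟨Equiv.ofBijective μ (Finite.injective_iff_bijective.1 hinj), hμ⟩

theorem finrank_mem_Icc {V : Submodule F (Fin n → F)} (h : V ≠ ⊥ ∧ V ≠ ⊤) :
    Module.finrank F V ∈ Set.Icc 1 (n - 1) := by
  have h1 : Module.finrank F V ≠ 0 := fun h0 => h.1 (Submodule.finrank_eq_zero.1 h0)
  have h2 := Submodule.finrank_lt h.2
  rw [Module.finrank_fin_fun] at h2
  constructor <;> omega

theorem IsRep.subset_image {f : Set (Submodule F (Fin n → F))} {M : Matrix (Fin n) (Fin n) F}
    (hM : IsRep f M) (hf : IsFlag f) : f ⊆ colSpan M '' Set.Icc 1 (n - 1) := fun V hV =>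
  ⟨_, finrank_mem_Icc (hf.2.2.2 V hV), hM.1 V hV⟩

theorem IsMaximalFlag.eq_image {f : Set (Submodule F (Fin n → F))}
    {M : Matrix (Fin n) (Fin n) F} (hf : IsMaximalFlag f) (hM : IsRep f M) :
    f = colSpan M '' Set.Icc 1 (n - 1) := by
  refine (hM.subset_image hf.1).antisymm ?_
  rintro _ ⟨j, hj, rfl⟩
  obtain ⟨V, hV, rfl⟩ := hf.2 j hj.1 hj.2
  rwa [hM.1 V hV]

theorem isMaximalFlag_image_colSpan (hn : 2 ≤ n) {M : Matrix (Fin n) (Fin n) F}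
    (h : colSpan M n = ⊤) : IsMaximalFlag (colSpan M '' Set.Icc 1 (n - 1)) := by
  refine ⟨⟨(Set.finite_Icc _ _).image _, ⟨_, 1, ⟨le_rfl, by omega⟩, rfl⟩, ?_, ?_⟩, ?_⟩
  · rintro _ ⟨i, -, rfl⟩ _ ⟨j, -, rfl⟩ -
    exact (le_total i j).imp (fun hij => colSpan_mono M hij) (fun hij => colSpan_mono M hij)
  · rintro _ ⟨j, ⟨hj1, hj2⟩, rfl⟩
    have hr := finrank_colSpan h (show j ≤ n by omega)
    constructor <;> intro he
    · rw [he, finrank_bot] at hr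
      omega
    · rw [he, finrank_top, Module.finrank_fin_fun] at hr
      omega
  · intro j h1 h2
    exact ⟨_, ⟨j, ⟨h1, h2⟩, rfl⟩, finrank_colSpan h (by omega)⟩

theorem IsRep.image_colSpan {f : Set (Submodule F (Fin n → F))} {M : Matrix (Fin n) (Fin n) F}
    (h : IsRep f M) : IsRep (colSpan M '' Set.Icc 1 (n - 1)) M := by
  refine ⟨?_, h.2⟩
  rintro _ ⟨j, ⟨hj1, hj2⟩, rfl⟩
  rw [finrank_colSpan h.2.1 (by omega)]

theorem colSpan_succ_eq {M N : Matrix (Fin n) (Fin n) F} (hM : colSpan M n = ⊤)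
    (hN : colSpan N n = ⊤) {j : Fin n} (hj : colSpan M j = colSpan N j)
    (hmem : Nᵀ j ∈ colSpan M (j + 1)) : colSpan M (j + 1) = colSpan N (j + 1) := by
  refine (Submodule.eq_of_le_of_finrank_eq (Submodule.span_le.2 ?_) ?_).symm
  · rintro _ ⟨i, hi, rfl⟩
    rcases Nat.lt_succ_iff_lt_or_eq.1 hi with hlt | heq
    · exact colSpan_mono M (Nat.le_succ _) (hj ▸ col_mem_colSpan N hlt)
    · exact Fin.ext heq ▸ hmem
  · exact (finrank_colSpan hN j.2).trans (finrank_colSpan hM j.2).symm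

/-- Every column lies in a block of `g` that ends at the dimension of a member of `g` or
at `n`. -/
theorem exists_block_end (g : Set (Submodule F (Fin n → F))) (j : Fin n) :
    ∃ b : ℕ, (j : ℕ) < b ∧ (b = n ∨ ∃ V ∈ g, Module.finrank F V = b) ∧
      ∀ k : Fin n, j ≤ k → (k : ℕ) < b → SameBlock g j k := by
  classical
  have hex : ∃ b : ℕ, (j : ℕ) < b ∧ (b = n ∨ ∃ V ∈ g, Module.finrank F V = b) :=
    ⟨n, j.2, Or.inl rfl⟩
  refine ⟨Nat.find hex, (Nat.find_spec hex).1, (Nat.find_spec hex).2, fun k hjk hk V hV => ?_⟩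
  exact ⟨fun h => hk.trans_le (Nat.find_min' hex ⟨h, Or.inr ⟨V, hV, rfl⟩⟩),
    fun h => lt_of_le_of_lt hjk h⟩

theorem IsMinRep.colSpan_eq_of_not_lexLt {g h : Set (Submodule F (Fin n → F))}
    {M N : Matrix (Fin n) (Fin n) F} {μ τ : Equiv.Perm (Fin n)} (hM : IsMinRep g M)
    (hN : IsRep h N) (hgh : g ⊆ h) (hμ : ∀ j, IsPivot M (μ j) j) (hτ : ∀ j, IsPivot N (τ j) j)
    (hlex : ¬ LexLt μ τ) (j : ℕ) (hj : j ≤ n) : colSpan M j = colSpan N j := by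
  induction j using Nat.strong_induction_on with
  | _ j ih =>
    rcases j with _ | j
    · simp [colSpan]
    · have hjn : j < n := hj
      obtain ⟨b, hjb, hb, hblock⟩ := exists_block_end g ⟨j, hjn⟩
      have hbeq : colSpan M b = colSpan N b := by
        rcases hb with rfl | ⟨V, hV, rfl⟩
        · rw [hM.1.2.1, hN.2.1]
        · rw [hM.1.1 V hV, hN.1 V (hgh hV)]
      have hjeq : colSpan M j = colSpan N j := ih j (Nat.lt_succ_self j) hjn.le
      obtain ⟨hle, hmem⟩ := pivot_le_of_colSpan_eq hμ hτ (j := ⟨j, hjn⟩) hjb hjeq hbeq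
        fun k hjk hkb => hM.2.2 _ _ _ _ (hblock k hjk.le hkb) (hμ _) (hμ k) hjk
      refine colSpan_succ_eq (j := ⟨j, hjn⟩) hM.1.2.1 hN.2.1 hjeq
        (hmem (hle.eq_of_not_lt fun hlt => hlex ⟨⟨j, hjn⟩, fun i hi => ?_, hlt⟩))
      have hij : (i : ℕ) < j := hi
      exact pivot_eq_of_colSpan_eq hμ hτ (ih i (by omega) (by omega))
        (ih (i + 1) (by omega) (by omega))

theorem IsMinRep.lexLt_of_ne {g h : Set (Submodule F (Fin n → F))}
    {M : Matrix (Fin n) (Fin n) F} {μ τ : Equiv.Perm (Fin n)} (hM : IsMinRep g M)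
    (hμ : ∀ j, IsPivot M (μ j) j) (hh : IsMaximalFlag h) (hgh : g ⊆ h)
    (hne : h ≠ colSpan M '' Set.Icc 1 (n - 1)) (hτ : IsLabel h τ) : LexLt μ τ := by
  obtain ⟨N, hN, hτ⟩ := hτ
  by_contra hlex
  refine hne ((hh.eq_image hN).trans (Set.image_congr fun j hj => ?_))
  have hj2 : j ≤ n - 1 := hj.2
  exact (hM.colSpan_eq_of_not_lexLt hN hgh hμ hτ hlex j (by omega)).symm

theorem IsLabel.unique {f : Set (Submodule F (Fin n → F))} (hf : IsMaximalFlag f)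
    {σ τ : Equiv.Perm (Fin n)} (hσ : IsLabel f σ) (hτ : IsLabel f τ) : σ = τ := by
  obtain ⟨M, hM, hσ⟩ := hσ
  obtain ⟨N, hN, hτ⟩ := hτ
  have heq : ∀ j ≤ n, colSpan M j = colSpan N j := by
    intro j hj
    rcases Nat.eq_zero_or_pos j with rfl | h0
    · simp [colSpan]
    · rcases hj.eq_or_lt with rfl | hlt
      · rw [hM.2.1, hN.2.1]
      · obtain ⟨V, hV, rfl⟩ := hf.2 j h0 (by omega)
        rw [hM.1 V hV, hN.1 V hV]
  exact Equiv.ext fun j => pivot_eq_of_colSpan_eq hσ hτ (heq _ j.2.le) (heq _ j.2)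

/-- for a flag `g` with minimal matrix representation `M`, the maximal flag `ĝ`
whose `j`-th subspace is the span of the first `j` columns of `M` contains `g`, its label is
lexicographically strictly smaller than the label of any other maximal flag containing `g`,
and consequently `minlabel g` is the label of `ĝ`. -/
theorem label_of_flag_is_minimal
    [Fintype F] (hn : 2 ≤ n)
    (g : Set (Submodule F (Fin n → F))) (hg : IsFlag g)
    (M : Matrix (Fin n) (Fin n) F) (hM : IsMinRep g M)
    (ghat : Set (Submodule F (Fin n → F)))
    (hghat : ghat = colSpan M '' Set.Icc 1 (n - 1)) :
    IsMaximalFlag ghat ∧ g ⊆ ghat ∧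
    ∀ σ : Equiv.Perm (Fin n), IsLabel ghat σ →
      (∀ (h : Set (Submodule F (Fin n → F))) (τ : Equiv.Perm (Fin n)),
          IsMaximalFlag h → g ⊆ h → h ≠ ghat → IsLabel h τ → LexLt σ τ) ∧
      IsMinlabel g σ := by
  subst hghat
  obtain ⟨μ, hμ⟩ := hM.1.exists_perm
  have hmax := isMaximalFlag_image_colSpan hn hM.1.2.1
  have hsub := hM.1.subset_image hg
  refine ⟨hmax, hsub, fun σ hσ => ?_⟩
  obtain rfl : σ = μ := hσ.unique hmax ⟨M, hM.1.image_colSpan, hμ⟩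
  refine ⟨fun h τ hh hgh hne hτ => hM.lexLt_of_ne hμ hh hgh hne hτ,
    ⟨_, hmax, hsub, hσ⟩, fun f τ hf hgf hτ => ?_⟩
  by_cases hfe : f = colSpan M '' Set.Icc 1 (n - 1)
  · subst hfe
    exact Or.inl (hσ.unique hmax hτ)
  · exact Or.inr (hM.lexLt_of_ne hμ hf hgf hfe hτ)
end

section
/- For every permutation σ ∈ Σ_n, the number of maximal flags in F^n with label σ equals q^{m_1 + m_2 + ⋯ + m_n}, where q is the cardinality of F and m_j = σ(j) − 1 − |{k ∈ {1,…,j−1} : σ(k) < σ(j)}| for each j = 1,…,n. -/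
open Matrix

variable {n : ℕ} {F : Type} [Field F]

/-- `M` has pivots `1` in the positions `(σ j, j)` and zeros to the right of every pivot. -/
structure IsNormalForm (σ : Equiv.Perm (Fin n)) (M : Matrix (Fin n) (Fin n) F) : Prop where
  apply_pivot : ∀ j, M (σ j) j = 1
  apply_below : ∀ r j, σ j < r → M r j = 0
  apply_right : ∀ k j, k < j → M (σ k) j = 0

theorem IsPivot.row_unique {M : Matrix (Fin n) (Fin n) F} {r s j : Fin n}
    (hr : IsPivot M r j) (hs : IsPivot M s j) : r = s := by
  rcases lt_trichotomy r s with h | h | h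
  · exact absurd (hr.2 s h) hs.1
  · exact h
  · exact absurd (hs.2 r h) hr.1

theorem IsRep.isNormalForm {f : Set (Submodule F (Fin n → F))} {M : Matrix (Fin n) (Fin n) F}
    {σ : Equiv.Perm (Fin n)} (h : IsRep f M) (hp : ∀ j, IsPivot M (σ j) j) :
    IsNormalForm σ M where
  apply_pivot j := h.2.2.1 _ _ (hp j)
  apply_below r j hr := (hp j).2 r hr
  apply_right k j hkj := h.2.2.2 _ k j (hp k) hkj

theorem exists_mulVec_of_mem_colSpan {M : Matrix (Fin n) (Fin n) F} {m : ℕ} {v : Fin n → F}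
    (hv : v ∈ colSpan M m) :
    ∃ c : Fin n → F, (∀ i : Fin n, m ≤ i → c i = 0) ∧ M *ᵥ c = v := by
  induction hv using Submodule.span_induction with
  | mem x hx =>
    obtain ⟨i, hi, rfl⟩ := hx
    refine ⟨Pi.single i 1, fun k hk => Pi.single_eq_of_ne ?_ _, by simp [Matrix.col]⟩
    rintro rfl
    exact absurd hi (not_lt.2 hk)
  | zero => exact ⟨0, by simp, by simp⟩
  | add x y _ _ hx hy =>
    obtain ⟨c, hc, rfl⟩ := hx
    obtain ⟨d, hd, rfl⟩ := hy
    exact ⟨c + d, fun i hi => by simp [hc i hi, hd i hi], Matrix.mulVec_add _ _ _⟩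
  | smul a x _ hx =>
    obtain ⟨c, hc, rfl⟩ := hx
    exact ⟨a • c, fun i hi => by simp [hc i hi], Matrix.mulVec_smul _ _ _⟩

namespace IsNormalForm

variable {σ : Equiv.Perm (Fin n)} {M N : Matrix (Fin n) (Fin n) F}

theorem isPivot (h : IsNormalForm σ M) (j : Fin n) : IsPivot M (σ j) j :=
  ⟨by simp [h.apply_pivot j], fun r hr => h.apply_below r j hr⟩

theorem coeff_eq_zero (h : IsNormalForm σ M) {m : ℕ} {c : Fin n → F}
    (hc : ∀ k : Fin n, (k : ℕ) < m → (M *ᵥ c) (σ k) = 0) (k : Fin n) (hk : (k : ℕ) < m) :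
    c k = 0 := by
  induction k using WellFoundedLT.induction with
  | ind k ih =>
    have hsum := hc k hk
    rw [Matrix.mulVec, dotProduct, Finset.sum_eq_single k] at hsum
    · simpa [h.apply_pivot k] using hsum
    · intro i _ hi
      rcases lt_or_gt_of_ne hi with hik | hki
      · rw [ih i hik (lt_trans hik hk), mul_zero]
      · rw [h.apply_right k i hki, zero_mul]
    · simp

theorem eq_zero_of_mem_colSpan (h : IsNormalForm σ M) {m : ℕ} {v : Fin n → F}
    (hv : v ∈ colSpan M m) (hz : ∀ k : Fin n, (k : ℕ) < m → v (σ k) = 0) : v = 0 := by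
  obtain ⟨c, hc, rfl⟩ := exists_mulVec_of_mem_colSpan hv
  have : c = 0 := funext fun i => by
    rcases lt_or_ge (i : ℕ) m with hi | hi
    · exact h.coeff_eq_zero hz i hi
    · exact hc i hi
  simp [this]

theorem linearIndependent (h : IsNormalForm σ M) :
    LinearIndependent F (fun i : Fin n => Mᵀ i) := by
  refine (Matrix.mulVec_injective_iff (M := M)).1 ?_
  refine (injective_iff_map_eq_zero M.mulVecLin).2 fun c hc => funext fun k => ?_
  exact h.coeff_eq_zero (m := n) (fun k _ => congrFun hc (σ k)) k k.2

theorem finrank_colSpan (h : IsNormalForm σ M) {m : ℕ} (hm : m ≤ n) :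
    Module.finrank F (colSpan M m) = m := by
  have hli := h.linearIndependent.comp (fun i : {i : Fin n // (i : ℕ) < m} => (i : Fin n))
    Subtype.val_injective
  have hspan : colSpan M m = Submodule.span F
      (Set.range ((fun i : Fin n => Mᵀ i) ∘ fun i : {i : Fin n // (i : ℕ) < m} => (i : Fin n))) := by
    rw [Set.range_comp, Subtype.range_coe_subtype, colSpan]
  rw [hspan, finrank_span_eq_card hli, Fintype.card_subtype, Fin.card_filter_val_lt,
    min_eq_right hm]

theorem colSpan_eq_top (h : IsNormalForm σ M) : colSpan M n = ⊤ :=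
  Submodule.eq_top_of_finrank_eq (by simp [h.finrank_colSpan le_rfl])

theorem eq_of_colSpan_eq (hM : IsNormalForm σ M) (hN : IsNormalForm σ N)
    (h : ∀ m ≤ n, colSpan M m = colSpan N m) : M = N := by
  have hcol : ∀ j, Mᵀ j - Nᵀ j = 0 := fun j => by
    have hmem : ∀ A : Matrix (Fin n) (Fin n) F, Aᵀ j ∈ colSpan A (j + 1) := fun A =>
      Submodule.subset_span ⟨j, Nat.lt_succ_self _, rfl⟩
    refine hM.eq_zero_of_mem_colSpan (m := j + 1)
      (Submodule.sub_mem _ (hmem M) (h (j + 1) j.2 ▸ hmem N)) fun k hk => ?_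
    rcases (Nat.lt_succ_iff.1 hk).lt_or_eq with hlt | heq
    · simp [hM.apply_right k j hlt, hN.apply_right k j hlt]
    · obtain rfl := Fin.ext heq
      simp [hM.apply_pivot, hN.apply_pivot]
  exact Matrix.transpose_injective (funext fun j => sub_eq_zero.1 (hcol j))

end IsNormalForm

/-- The set of spans of the first `1, …, n - 1` columns of `M`. -/
def columnFlag (M : Matrix (Fin n) (Fin n) F) : Set (Submodule F (Fin n → F)) :=
  colSpan M '' Set.Ico 1 n

namespace IsNormalForm

variable {σ : Equiv.Perm (Fin n)} {M N : Matrix (Fin n) (Fin n) F}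

theorem isRep_columnFlag (h : IsNormalForm σ M) : IsRep (columnFlag M) M := by
  refine ⟨?_, h.colSpan_eq_top, fun r j hr => ?_, fun r j j' hr hj => ?_⟩
  · rintro _ ⟨m, hm, rfl⟩
    rw [h.finrank_colSpan hm.2.le]
  · rw [hr.row_unique (h.isPivot j), h.apply_pivot]
  · rw [hr.row_unique (h.isPivot j), h.apply_right j j' hj]

theorem isMaximalFlag_columnFlag (h : IsNormalForm σ M) (hn : 2 ≤ n) :
    IsMaximalFlag (columnFlag M) := by
  refine ⟨⟨(Set.finite_Ico 1 n).image _, ⟨_, 1, ⟨le_rfl, hn⟩, rfl⟩, ?_, ?_⟩, fun j hj hjn => ?_⟩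
  · rintro _ ⟨a, -, rfl⟩ _ ⟨b, -, rfl⟩ -
    exact (le_total a b).imp (fun h => colSpan_mono M h) (fun h => colSpan_mono M h)
  · rintro _ ⟨m, ⟨hm, hmn⟩, rfl⟩
    have hr := h.finrank_colSpan hmn.le
    constructor <;> intro he <;> rw [he] at hr <;> simp at hr <;> omega
  · have hj' : j < n := by omega
    exact ⟨_, ⟨j, ⟨hj, hj'⟩, rfl⟩, h.finrank_colSpan hj'.le⟩

theorem eq_of_columnFlag_eq (hM : IsNormalForm σ M) (hN : IsNormalForm σ N)
    (h : columnFlag M = columnFlag N) : M = N := by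
  refine hM.eq_of_colSpan_eq hN fun m hm => ?_
  rcases Nat.eq_zero_or_pos m with rfl | hpos
  · simp [colSpan]
  rcases hm.lt_or_eq with hlt | rfl
  · have hmem : colSpan M m ∈ columnFlag N := h ▸ ⟨m, ⟨hpos, hlt⟩, rfl⟩
    obtain ⟨k, hk, hkm⟩ := hmem
    have hr := congrArg (fun V : Submodule F (Fin n → F) => Module.finrank F V) hkm
    simp only [hN.finrank_colSpan hk.2.le, hM.finrank_colSpan hm] at hr
    rw [← hkm, hr]
  · rw [hM.colSpan_eq_top, hN.colSpan_eq_top]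

end IsNormalForm

theorem IsMaximalFlag.eq_columnFlag {f : Set (Submodule F (Fin n → F))}
    {M : Matrix (Fin n) (Fin n) F} (hf : IsMaximalFlag f) (h : IsRep f M) :
    f = columnFlag M := by
  ext V
  constructor
  · intro hV
    obtain ⟨hbot, htop⟩ := hf.1.2.2.2 V hV
    refine ⟨Module.finrank F V, ⟨?_, ?_⟩, h.1 V hV⟩
    · exact Nat.one_le_iff_ne_zero.2 fun h0 => hbot (Submodule.finrank_eq_zero.1 h0)
    · simpa using Submodule.finrank_lt htop
  · rintro ⟨m, ⟨hm, hmn⟩, rfl⟩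
    obtain ⟨W, hW, rfl⟩ := hf.2 m hm (by omega)
    rwa [h.1 W hW]

theorem setOf_maximal_flags_with_label (hn : 2 ≤ n) (σ : Equiv.Perm (Fin n)) :
    {f : Set (Submodule F (Fin n → F)) | IsMaximalFlag f ∧ IsLabel f σ} =
      columnFlag '' {M | IsNormalForm σ M} := by
  ext f
  constructor
  · rintro ⟨hf, M, hM, hp⟩
    exact ⟨M, hM.isNormalForm hp, (hf.eq_columnFlag hM).symm⟩
  · rintro ⟨M, hM, rfl⟩
    exact ⟨hM.isMaximalFlag_columnFlag hn, M, hM.isRep_columnFlag, hM.isPivot⟩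

/-- The row indices of the unconstrained entries in column `j` of a normal form. -/
def freeRows (σ : Equiv.Perm (Fin n)) (j : Fin n) : Finset (Fin n) :=
  Finset.Iio (σ j) \ (Finset.univ.filter fun k => k < j ∧ σ k < σ j).image σ

theorem card_freeRows (σ : Equiv.Perm (Fin n)) (j : Fin n) :
    (freeRows σ j).card = (σ j : ℕ) - {k : Fin n | k < j ∧ σ k < σ j}.ncard := by
  rw [freeRows, Finset.card_sdiff_of_subset, Fin.card_Iio,
    Finset.card_image_of_injective _ σ.injective, ← Set.ncard_coe_finset]
  · simp
  · intro r
    simp only [Finset.mem_image, Finset.mem_filter, Finset.mem_univ, true_and, Finset.mem_Iio]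
    rintro ⟨k, ⟨-, hk⟩, rfl⟩
    exact hk

theorem isNormalForm_iff {σ : Equiv.Perm (Fin n)} {M : Matrix (Fin n) (Fin n) F} :
    IsNormalForm σ M ↔ ∀ r j, r ∉ freeRows σ j → M r j = if r = σ j then 1 else 0 := by
  have hfree : ∀ r j, r ∉ freeRows σ j ↔ σ j ≤ r ∨ ∃ k < j, σ k = r := fun r j => by
    simp only [freeRows, Finset.mem_sdiff, Finset.mem_Iio, Finset.mem_image, Finset.mem_filter,
      Finset.mem_univ, true_and, not_and_or, not_lt, not_not]
    constructor
    · rintro (h | ⟨k, ⟨hk, -⟩, rfl⟩)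
      exacts [Or.inl h, Or.inr ⟨k, hk, rfl⟩]
    · rintro (h | ⟨k, hk, rfl⟩)
      · exact Or.inl h
      · exact (le_or_gt (σ j) (σ k)).imp id fun h => ⟨k, ⟨hk, h⟩, rfl⟩
  simp only [hfree]
  constructor
  · rintro h r j (hr | ⟨k, hk, rfl⟩)
    · rcases hr.lt_or_eq with hlt | rfl
      · rw [h.apply_below r j hlt, if_neg hlt.ne']
      · rw [h.apply_pivot, if_pos rfl]
    · rw [h.apply_right k j hk, if_neg (σ.injective.ne hk.ne)]
  · intro h
    refine ⟨fun j => ?_, fun r j hr => ?_, fun k j hk => ?_⟩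
    · rw [h _ _ (Or.inl le_rfl), if_pos rfl]
    · rw [h _ _ (Or.inl hr.le), if_neg hr.ne']
    · rw [h _ _ (Or.inr ⟨k, hk, rfl⟩), if_neg (σ.injective.ne hk.ne)]

theorem ncard_setOf_isNormalForm [Fintype F] (σ : Equiv.Perm (Fin n)) :
    {M : Matrix (Fin n) (Fin n) F | IsNormalForm σ M}.ncard =
      Fintype.card F ^ ∑ j, (freeRows σ j).card := by
  classical
  let T : Fin n → Fin n → Finset F := fun r j =>
    if r ∈ freeRows σ j then Finset.univ else {if r = σ j then 1 else 0}
  have hset : {A : Fin n → Fin n → F | IsNormalForm σ (Matrix.of A)} =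
      (Fintype.piFinset fun r => Fintype.piFinset (T r) : Finset (Fin n → Fin n → F)) := by
    ext A
    rw [Set.mem_ofPred_eq, isNormalForm_iff, Finset.mem_coe]
    simp only [Fintype.mem_piFinset, Matrix.of_apply]
    refine forall₂_congr fun r j => ?_
    by_cases h : r ∈ freeRows σ j <;> simp [T, h]
  have hcard : ∀ r j, (T r j).card = if r ∈ freeRows σ j then Fintype.card F else 1 :=
    fun r j => by by_cases h : r ∈ freeRows σ j <;> simp [T, h]
  change {A : Fin n → Fin n → F | IsNormalForm σ (Matrix.of A)}.ncard = _
  rw [hset, Set.ncard_coe_finset]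
  simp only [Fintype.card_piFinset, hcard]
  rw [Finset.prod_comm, ← Finset.prod_pow_eq_pow_sum]
  simp

/-- the number of maximal flags with label `σ` is `q^{m_1 + ⋯ + m_n}` where
`m_j = σ(j) - 1 - |{k < j : σ(k) < σ(j)}|` (in 0-based indexing, `σ(j) - 1` becomes `(σ j : ℕ)`). -/
theorem card_maximal_flags_with_label
    [Fintype F] (hn : 2 ≤ n) (σ : Equiv.Perm (Fin n)) :
    {f : Set (Submodule F (Fin n → F)) | IsMaximalFlag f ∧ IsLabel f σ}.ncard =
      Fintype.card F ^
        (∑ j : Fin n, ((σ j : ℕ) - {k : Fin n | k < j ∧ σ k < σ j}.ncard)) := by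
  have hinj : Set.InjOn columnFlag {M : Matrix (Fin n) (Fin n) F | IsNormalForm σ M} :=
    fun _ hM _ hN h => hM.eq_of_columnFlag_eq hN h
  rw [setOf_maximal_flags_with_label hn, hinj.ncard_image, ncard_setOf_isNormalForm]
  simp only [card_freeRows]
end
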